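/- arXiv:1412.0444 — 2 statements merged into one kernel-verified Lean document; each statement's English description precedes it below -/
import Mathlib

section
/- Let G be a connected simple graph on {1,…,n}, let α ∈ ℤ^n, and let w = i_1 i_2 … i_l be a word over {1,…,n}. For 1 ≤ k ≤ l set α^{(k)} = T_{i_k}(T_{i_{k−1}}(⋯T_{i_1}(α)⋯)). Then α^{(k)} ≤ α (toppling dominance) for all 1 ≤ k ≤ l if and only if w is a Yamanouchi word. -/
open Finset

/-- The toppling vector `Δ_i` of vertex `i` in the graph `G`:
it has `-(deg i)` at position `i`, `1` at each neighbor of `i`, and `0` elsewhere. -/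
def topDelta {n : ℕ} (G : SimpleGraph (Fin n)) [DecidableRel G.Adj] (i : Fin n) :
    Fin n → ℤ :=
  fun j => if j = i then -(G.degree i : ℤ) else if G.Adj i j then 1 else 0

/-- The map `T^a : ℤ^n → ℤ^n`, `α ↦ α + Σ_i a_i • Δ_i`. -/
def topT {n : ℕ} (G : SimpleGraph (Fin n)) [DecidableRel G.Adj] (a : Fin n → ℤ)
    (α : Fin n → ℤ) : Fin n → ℤ :=
  α + ∑ i, a i • topDelta G i

/-- Toppling dominance: `β ≤ α` iff `β = T^λ(α)` for some weakly decreasing `λ ∈ ℕ^n`. -/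
def topDom {n : ℕ} (G : SimpleGraph (Fin n)) [DecidableRel G.Adj]
    (β α : Fin n → ℤ) : Prop :=
  ∃ l : Fin n → ℕ, Antitone l ∧ β = topT G (fun i => (l i : ℤ)) α

/-- Apply the topplings of the letters of a word, from left to right:
the word `i_1 i_2 … i_l` sends `α` to `T_{i_l}(⋯ T_{i_2}(T_{i_1}(α)) ⋯)`. -/
def applyWord {n : ℕ} (G : SimpleGraph (Fin n)) [DecidableRel G.Adj]
    (w : List (Fin n)) (α : Fin n → ℤ) : Fin n → ℤ :=
  w.foldl (fun β i => β + topDelta G i) α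

/-- A word over the alphabet `{1,…,n}` (encoded as `Fin n`, with letter `i+1`
encoded by `i : Fin n`) is Yamanouchi if in every prefix each letter occurs at
least as often as its successor. -/
def IsYamanouchi {n : ℕ} (w : List (Fin n)) : Prop :=
  ∀ k : ℕ, ∀ i j : Fin n, (j : ℕ) + 1 = (i : ℕ) →
    (w.take k).count i ≤ (w.take k).count j

theorem applyWord_eq_topT_count {n : ℕ} (G : SimpleGraph (Fin n)) [DecidableRel G.Adj]
    (w : List (Fin n)) (α : Fin n → ℤ) :
    applyWord G w α = topT G (fun i => (w.count i : ℤ)) α := by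
  induction w generalizing α with
  | nil => simp [applyWord, topT]
  | cons a w ih =>
    have h : applyWord G (a :: w) α = applyWord G w (α + topDelta G a) := rfl
    rw [h, ih]
    simp [topT, List.count_cons, add_smul, Finset.sum_add_distrib, ite_smul]
    abel

theorem sum_smul_topDelta_apply {n : ℕ} (G : SimpleGraph (Fin n)) [DecidableRel G.Adj]
    (a : Fin n → ℤ) (j : Fin n) :
    (∑ i, a i • topDelta G i) j = -(G.lapMatrix ℤ).mulVec a j := by
  rw [SimpleGraph.lapMatrix_mulVec_apply, SimpleGraph.neighborFinset_eq_filter,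
    Finset.sum_filter, Finset.sum_apply, neg_sub, sub_eq_add_neg, ← neg_mul]
  have h : ∀ i, (a i • topDelta G i) j =
      (if G.Adj j i then a i else 0) + if j = i then -(G.degree i : ℤ) * a i else 0 := by
    intro i
    by_cases hij : j = i
    · subst hij
      simp [topDelta, mul_comm]
    · simp [topDelta, hij, G.adj_comm i j]
  simp [h, Finset.sum_add_distrib]

/-- For a connected graph, the only linear relations between the toppling vectors
are those with constant coefficients. -/
theorem eq_of_sum_smul_topDelta_eq_zero {n : ℕ} {G : SimpleGraph (Fin n)}
    [DecidableRel G.Adj] (hG : G.Connected) {a : Fin n → ℤ}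
    (h : ∑ i, a i • topDelta G i = 0) (i j : Fin n) : a i = a j := by
  have hL : (G.lapMatrix ℝ).mulVec (fun i => (a i : ℝ)) = 0 := by
    ext k
    have hk := sum_smul_topDelta_apply G a k
    rw [h, Pi.zero_apply, eq_comm, neg_eq_zero, SimpleGraph.lapMatrix_mulVec_apply] at hk
    rw [SimpleGraph.lapMatrix_mulVec_apply, Pi.zero_apply]
    exact_mod_cast hk
  exact_mod_cast G.lapMatrix_mulVec_eq_zero_iff_forall_reachable.mp hL i j (hG.preconnected i j)

theorem topDom_topT_iff {n : ℕ} {G : SimpleGraph (Fin n)} [DecidableRel G.Adj]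
    (hG : G.Connected) (c : Fin n → ℕ) (α : Fin n → ℤ) :
    topDom G (topT G (fun i => (c i : ℤ)) α) α ↔ Antitone c := by
  refine ⟨?_, fun hc => ⟨c, hc, rfl⟩⟩
  rintro ⟨l, hl, h⟩ i j hij
  have hd : ∑ i, ((c i : ℤ) - l i) • topDelta G i = 0 := by
    simp only [sub_smul, Finset.sum_sub_distrib, sub_eq_zero]
    exact add_left_cancel h
  have hconst := eq_of_sum_smul_topDelta_eq_zero hG hd i j
  have hlij := hl hij
  omega

theorem antitone_iff_forall_val_succ {n : ℕ} (c : Fin n → ℕ) :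
    Antitone c ↔ ∀ i j : Fin n, (j : ℕ) + 1 = (i : ℕ) → c i ≤ c j := by
  constructor
  · intro hc i j hij
    exact hc (Fin.le_def.mpr (by omega))
  · intro h
    cases n with
    | zero => exact fun i => i.elim0
    | succ m => exact Fin.antitone_iff_succ_le.mpr fun i => h _ _ (by simp)

/-- Every intermediate configuration produced by a word of topplings dominates
(is dominated by) the starting one, i.e. `α^{(k)} ≤ α` for all `1 ≤ k ≤ l`,
iff the word is Yamanouchi. -/
theorem intermediate_dom_iff_yamanouchi {n : ℕ} (hn : 0 < n)
    (G : SimpleGraph (Fin n)) [DecidableRel G.Adj] (hG : G.Connected)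
    (α : Fin n → ℤ) (w : List (Fin n)) :
    (∀ k : ℕ, 1 ≤ k → k ≤ w.length → topDom G (applyWord G (w.take k) α) α) ↔
      IsYamanouchi w := by
  have key : ∀ k, topDom G (applyWord G (w.take k) α) α ↔
      ∀ i j : Fin n, (j : ℕ) + 1 = (i : ℕ) → (w.take k).count i ≤ (w.take k).count j := by
    intro k
    rw [applyWord_eq_topT_count, topDom_topT_iff hG, antitone_iff_forall_val_succ]
  refine ⟨fun h k => ?_, fun h k _ _ => (key k).mpr (h k)⟩
  rcases Nat.eq_zero_or_pos k with rfl | hk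
  · simp
  rcases le_total k w.length with hkl | hkl
  · exact (key k).mp (h k hk hkl)
  · rw [List.take_of_length_le hkl]
    rcases Nat.eq_zero_or_pos w.length with hw | hw
    · simp [List.length_eq_zero_iff.mp hw]
    · simpa using (key w.length).mp (h _ hw le_rfl)
end

section
/- Let G be a connected simple graph on {1,…,n} and let λ ∈ P_n with conjugate partition λ′ defined by λ′_j = #{i : λ_i ≥ j}. Then T^λ = T_{[λ′_1]} ∘ T_{[λ′_2]} ∘ … ∘ T_{[λ′_{λ_1}]} (as maps ℤ^n → ℤ^n), and this expression is unique: for any finite multiset M of elements of {1,…,n−1}, the composition ∘_{m∈M} T_{[m]} equals T^λ if and only if M is the multiset {λ′_1, λ′_2, …, λ′_{λ_1}}. -/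
open Finset

/-- `T_{[m]} = T_1 ∘ T_2 ∘ … ∘ T_m` (1-based: it topples the first `m` vertices,
i.e. the vertices of index `< m` in `Fin n`). -/
def Tbracket {n : ℕ} (G : SimpleGraph (Fin n)) [DecidableRel G.Adj] (m : ℕ)
    (α : Fin n → ℤ) : Fin n → ℤ :=
  α + ∑ i ∈ Finset.univ.filter (fun i : Fin n => (i : ℕ) < m), topDelta G i

/-- The multiset `{λ′_1, λ′_2, …, λ′_{λ_1}}` of the parts of the conjugate
partition of `λ`, where `λ′_j = #{i : λ_i ≥ j}`. -/
def conjParts {n : ℕ} (hn : 0 < n) (l : Fin n → ℕ) : Multiset ℕ :=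
  (Finset.Icc 1 (l ⟨0, hn⟩)).val.map
    (fun j => (Finset.univ.filter (fun i : Fin n => j ≤ l i)).card)

/-- The composition of a list of maps `T_{[m]}` topples vertex `i` once for each `m > i`. -/
theorem foldr_Tbracket_eq_topT {n : ℕ} (G : SimpleGraph (Fin n)) [DecidableRel G.Adj]
    (L : List ℕ) :
    L.foldr (fun m f => Tbracket G m ∘ f) id =
      topT G (fun i => (((L : Multiset ℕ).countP ((i : ℕ) < ·) : ℕ) : ℤ)) := by
  induction L with
  | nil => funext α; simp [topT]
  | cons m L ih =>
    funext α
    rw [List.foldr_cons, ih, Function.comp_apply]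
    simp only [Tbracket, topT, ← Multiset.cons_coe, Multiset.countP_cons, Nat.cast_add,
      add_smul, Finset.sum_add_distrib, Finset.sum_filter, add_assoc, Nat.cast_ite, Nat.cast_one,
      Nat.cast_zero, ite_smul, one_smul, zero_smul]

theorem topT_apply_eq_sub_lapMatrix_mulVec {n : ℕ} (G : SimpleGraph (Fin n))
    [DecidableRel G.Adj] (a α : Fin n → ℤ) (j : Fin n) :
    ((topT G a α j : ℤ) : ℝ) = α j - (G.lapMatrix ℝ).mulVec (fun i => (a i : ℝ)) j := by
  rw [SimpleGraph.lapMatrix_mulVec_apply]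
  have h (i : Fin n) : a i * topDelta G i j =
      -(if i = j then (G.degree j : ℤ) * a j else 0) + if G.Adj j i then a i else 0 := by
    by_cases hij : j = i
    · subst hij; simp [topDelta, mul_comm]
    · simp [topDelta, hij, Ne.symm hij, G.adj_comm i j]
  simp only [topT, Pi.add_apply, Finset.sum_apply, Pi.smul_apply, smul_eq_mul, h,
    Finset.sum_add_distrib, Finset.sum_neg_distrib, Finset.sum_ite_eq', Finset.mem_univ, if_true]
  rw [← Finset.sum_filter, ← SimpleGraph.neighborFinset_eq_filter]
  push_cast
  ring

/-- On a connected graph, `T^a` determines `a` up to a constant vector. -/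
theorem sub_eq_sub_of_topT_eq {n : ℕ} {G : SimpleGraph (Fin n)} [DecidableRel G.Adj]
    (hG : G.Connected) {a b : Fin n → ℤ} (h : topT G a = topT G b) (i j : Fin n) :
    a i - b i = a j - b j := by
  have hker : (G.lapMatrix ℝ).mulVec ((fun i => (a i : ℝ)) - fun i => (b i : ℝ)) = 0 := by
    funext k
    have ha := topT_apply_eq_sub_lapMatrix_mulVec G a 0 k
    have hb := topT_apply_eq_sub_lapMatrix_mulVec G b 0 k
    rw [h] at ha
    rw [Matrix.mulVec_sub, Pi.sub_apply, Pi.zero_apply]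
    linarith
  have hreal : (a i : ℝ) - b i = a j - b j :=
    G.lapMatrix_mulVec_eq_zero_iff_forall_reachable.1 hker i j (hG.preconnected i j)
  exact_mod_cast hreal

/-- A multiset of positive naturals is determined by its tail counts. -/
theorem Multiset.eq_of_countP_lt_eq {M N : Multiset ℕ} (hM : 0 ∉ M) (hN : 0 ∉ N)
    (h : ∀ i : ℕ, M.countP (i < ·) = N.countP (i < ·)) : M = N := by
  have key (M : Multiset ℕ) (i : ℕ) :
      M.countP (i < ·) = M.count (i + 1) + M.countP (i + 1 < ·) := by
    induction M using Multiset.induction_on with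
    | empty => simp
    | cons m M ih =>
      simp only [Multiset.countP_cons, Multiset.count_cons, ih]
      split_ifs <;> omega
  ext k
  cases k with
  | zero => rw [Multiset.count_eq_zero_of_notMem hM, Multiset.count_eq_zero_of_notMem hN]
  | succ i =>
    have := h i
    rw [key M, key N, h (i + 1)] at this
    omega

theorem lt_card_filter_le_iff_of_antitone {n : ℕ} {l : Fin n → ℕ} (hl : Antitone l)
    (i : Fin n) (j : ℕ) :
    (i : ℕ) < (Finset.univ.filter (fun k : Fin n => j ≤ l k)).card ↔ j ≤ l i := by
  constructor
  · contrapose!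
    intro hj
    calc _ ≤ (Finset.Iio i).card := Finset.card_le_card fun k hk => by
          simp only [Finset.mem_filter, Finset.mem_univ, true_and] at hk
          by_contra hki
          have := hl (not_lt.1 (Finset.mem_Iio.not.1 hki))
          omega
      _ = i := Fin.card_Iio i
  · intro hj
    calc (i : ℕ) < (Finset.Iic i).card := by simp
      _ ≤ _ := Finset.card_le_card fun k hk => by
        simpa using hj.trans (hl (Finset.mem_Iic.1 hk))

theorem countP_lt_conjParts {n : ℕ} (hn : 0 < n) {l : Fin n → ℕ} (hl : Antitone l)
    (i : Fin n) : (conjParts hn l).countP ((i : ℕ) < ·) = l i := by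
  have h0 : l i ≤ l ⟨0, hn⟩ := hl (Fin.mk_le_of_le_val (Nat.zero_le _))
  have hset : (Finset.Icc 1 (l ⟨0, hn⟩)).filter (· ≤ l i) = Finset.Icc 1 (l i) := by
    ext j
    simp only [Finset.mem_filter, Finset.mem_Icc]
    omega
  simp only [conjParts, Multiset.countP_map, lt_card_filter_le_iff_of_antitone hl]
  rw [← Finset.filter_val, Finset.card_val, hset, Nat.card_Icc, Nat.add_sub_cancel]

theorem pos_and_le_of_mem_conjParts {n : ℕ} (hn : 0 < n) {l : Fin n → ℕ} (hl : Antitone l)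
    {k : Fin n} (hk : l k = 0) {m : ℕ} (hm : m ∈ conjParts hn l) : 1 ≤ m ∧ m ≤ k := by
  simp only [conjParts, Multiset.mem_map, Finset.mem_val, Finset.mem_Icc] at hm
  obtain ⟨j, ⟨hj1, hj⟩, rfl⟩ := hm
  have hfirst := (lt_card_filter_le_iff_of_antitone hl ⟨0, hn⟩ j).2 hj
  have hlt := (lt_card_filter_le_iff_of_antitone hl k j).not.2 (by omega)
  exact ⟨hfirst, not_lt.1 hlt⟩

/-- For `λ ∈ P_n`, `T^λ = T_{[λ′_1]} ∘ T_{[λ′_2]} ∘ … ∘ T_{[λ′_{λ_1}]}`, and this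
expression is unique: a finite multiset `M` of elements of `{1,…,n−1}` satisfies
`∘_{m ∈ M} T_{[m]} = T^λ` iff `M` is the multiset `{λ′_1, …, λ′_{λ_1}}`. -/
theorem topT_eq_conj_comp {n : ℕ} (hn : 0 < n) (G : SimpleGraph (Fin n))
    [DecidableRel G.Adj] (hG : G.Connected)
    (l : Fin n → ℕ) (hl : Antitone l) (hlast : l ⟨n - 1, by omega⟩ = 0) :
    ((conjParts hn l).toList.foldr (fun m f => Tbracket G m ∘ f) id =
        topT G (fun i => (l i : ℤ))) ∧
      ∀ L : List ℕ, (∀ m ∈ L, 1 ≤ m ∧ m ≤ n - 1) →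
        (L.foldr (fun m f => Tbracket G m ∘ f) id = topT G (fun i => (l i : ℤ)) ↔
          (L : Multiset ℕ) = conjParts hn l) := by
  have hcomp : ∀ L : List ℕ, (L : Multiset ℕ) = conjParts hn l →
      L.foldr (fun m f => Tbracket G m ∘ f) id = topT G (fun i => (l i : ℤ)) := fun L hL => by
    simp only [foldr_Tbracket_eq_topT, hL, countP_lt_conjParts hn hl]
  refine ⟨hcomp _ (Multiset.coe_toList _), fun L hL => ⟨fun h => ?_, hcomp L⟩⟩
  have countP_eq_zero {M : Multiset ℕ} (hM : ∀ m ∈ M, 1 ≤ m ∧ m ≤ n - 1) {i : ℕ}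
      (hi : n - 1 ≤ i) : M.countP (i < ·) = 0 :=
    Multiset.countP_eq_zero.2 fun m hm => not_lt.2 ((hM m hm).2.trans hi)
  have hL' : ∀ m ∈ (L : Multiset ℕ), 1 ≤ m ∧ m ≤ n - 1 := hL
  have hC : ∀ m ∈ conjParts hn l, 1 ≤ m ∧ m ≤ n - 1 :=
    fun m hm => pos_and_le_of_mem_conjParts hn hl hlast hm
  refine Multiset.eq_of_countP_lt_eq (fun h0 => by simpa using hL' 0 h0)
    (fun h0 => by simpa using hC 0 h0) fun i => ?_
  by_cases hi : n - 1 ≤ i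
  · rw [countP_eq_zero hL' hi, countP_eq_zero hC hi]
  · rw [foldr_Tbracket_eq_topT] at h
    have hsub := sub_eq_sub_of_topT_eq hG h ⟨i, by omega⟩ ⟨n - 1, by omega⟩
    rw [countP_lt_conjParts hn hl ⟨i, by omega⟩]
    simp only [hlast, countP_eq_zero hL' le_rfl] at hsub
    omega
end
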